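/- arXiv:2307.00289 — 2 statements merged into one kernel-verified Lean document; each statement's English description precedes it below -/
import Mathlib

section
/- For α ∈ ℂ, let 𝔑₀₈^α be the 4-dimensional complex Leibniz algebra with basis e₁,e₂,e₃,e₄ and nonzero products of basis vectors e₁e₁ = e₃, e₁e₂ = e₄, e₂e₁ = −αe₃, e₂e₂ = −e₄. If α ≠ 1, then H²(𝔑₀₈^α,ℂ) has dimension 4 with basis the classes [Δ₂₁], [Δ₂₂], [Δ₃₁], [Δ₄₂]; if α = 1, then H²(𝔑₀₈^1,ℂ) has dimension 5 with basis the classes [Δ₂₁], [Δ₂₂], [Δ₃₁], [Δ₄₂], [Δ₃₂+Δ₄₁]. -/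
noncomputable section

/-- The bilinear multiplication on `ℂⁿ` determined by structure constants `c`,
with `eᵢ eⱼ = ∑ₖ c i j k • eₖ`. -/
def mulOf {n : ℕ} (c : Fin n → Fin n → Fin n → ℂ) (x y : Fin n → ℂ) : Fin n → ℂ :=
  fun k => ∑ i, ∑ j, x i * y j * c i j k

/-- The bilinear form on `ℂⁿ` determined by the matrix `M`, with `θ(eᵢ,eⱼ) = M i j`. -/
def formOf {n : ℕ} (M : Matrix (Fin n) (Fin n) ℂ) (x y : Fin n → ℂ) : ℂ :=
  ∑ i, ∑ j, x i * M i j * y j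

/-- `M` represents a cocycle: `θ(xy,z) = θ(xz,y) + θ(x,yz)` for all `x,y,z`. -/
def IsCocycle {n : ℕ} (c : Fin n → Fin n → Fin n → ℂ) (M : Matrix (Fin n) (Fin n) ℂ) : Prop :=
  ∀ x y z : Fin n → ℂ,
    formOf M (mulOf c x y) z = formOf M (mulOf c x z) y + formOf M x (mulOf c y z)

/-- The bilinear form `Δ_{ij}` with `Δ_{ij}(e_l,e_m) = δ_{il} δ_{jm}` (as a matrix). -/
def Δ {n : ℕ} (i j : Fin n) : Matrix (Fin n) (Fin n) ℂ :=
  fun l m => if l = i ∧ m = j then 1 else 0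

/-- `H²` of the algebra with structure constants `c` has dimension `d`, and the classes of
the cocycles `M 0, …, M (d-1)` form a basis: each `M i` is a cocycle, and every cocycle `N`
is, for a unique coefficient vector `a`, the sum of `∑ i, a i • M i` and a coboundary
`(x,y) ↦ f(xy)` (where `f` is the linear functional with coefficients `g`). -/
def HBasis {n d : ℕ} (c : Fin n → Fin n → Fin n → ℂ)
    (M : Fin d → Matrix (Fin n) (Fin n) ℂ) : Prop :=
  (∀ i, IsCocycle c (M i)) ∧
  (∀ N : Matrix (Fin n) (Fin n) ℂ, IsCocycle c N →
    ∃! a : Fin d → ℂ, ∃ g : Fin n → ℂ, ∀ x y : Fin n → ℂ,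
      formOf N x y = (∑ i, a i * formOf (M i) x y) + ∑ l, mulOf c x y l * g l)

/-- Every cocycle differs by a coboundary from a cocycle additionally satisfying the
"symmetric" identity `θ(x,yz) = θ(xy,z) + θ(y,xz)`, i.e. `H² = H²_𝒮`. -/
def SymmReduce {n : ℕ} (c : Fin n → Fin n → Fin n → ℂ) : Prop :=
  ∀ N : Matrix (Fin n) (Fin n) ℂ, IsCocycle c N →
    ∃ (N' : Matrix (Fin n) (Fin n) ℂ) (g : Fin n → ℂ),
      IsCocycle c N' ∧
      (∀ x y z : Fin n → ℂ,
        formOf N' x (mulOf c y z) = formOf N' (mulOf c x y) z + formOf N' y (mulOf c x z)) ∧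
      (∀ x y : Fin n → ℂ, formOf N x y = formOf N' x y + ∑ l, mulOf c x y l * g l)


/-- The 4-dimensional Leibniz algebra `𝔑₀₈^α`:
`e₁e₁ = e₃`, `e₁e₂ = e₄`, `e₂e₁ = -αe₃`, `e₂e₂ = -e₄`. -/
def cM08 (α : ℂ) : Fin 4 → Fin 4 → Fin 4 → ℂ := fun i j k =>
  (if i = 0 ∧ j = 0 ∧ k = 2 then 1 else 0) +
  (if i = 0 ∧ j = 1 ∧ k = 3 then 1 else 0) +
  (if i = 1 ∧ j = 0 ∧ k = 2 then -α else 0) +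
  (if i = 1 ∧ j = 1 ∧ k = 3 then -1 else 0)

theorem formOf_Δ {n : ℕ} (i j : Fin n) (x y : Fin n → ℂ) :
    formOf (Δ i j) x y = x i * y j := by
  unfold formOf Δ
  rw [Finset.sum_eq_single i, Finset.sum_eq_single j]
  · simp
  · intro b _ hb
    simp [hb]
  · simp
  · intro b _ hb
    simp [hb]
  · simp

theorem formOf_add {n : ℕ} (M N : Matrix (Fin n) (Fin n) ℂ) (x y : Fin n → ℂ) :
    formOf (M + N) x y = formOf M x y + formOf N x y := by
  simp only [formOf, Matrix.add_apply, mul_add, add_mul, Finset.sum_add_distrib]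

theorem formOf_single {n : ℕ} (M : Matrix (Fin n) (Fin n) ℂ) (i j : Fin n) :
    formOf M (Pi.single i 1) (Pi.single j 1) = M i j := by
  simp [formOf, Pi.single_apply]

theorem mulOf_cM08 (α : ℂ) (x y : Fin 4 → ℂ) :
    mulOf (cM08 α) x y =
      ![0, 0, x 0 * y 0 - α * (x 1 * y 0), x 0 * y 1 - x 1 * y 1] := by
  funext k
  fin_cases k <;> simp [mulOf, cM08, Fin.sum_univ_four] <;> ring

/-- The linear equations on the entries of a cocycle. -/
theorem cocycle_entries (α : ℂ) (N : Matrix (Fin 4) (Fin 4) ℂ) (h : IsCocycle (cM08 α) N) :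
    (∀ i, N i 2 = 0) ∧ (∀ i, N i 3 = 0) ∧ N 2 1 = N 3 0 ∧ α * N 2 1 = N 3 0 := by
  have h2 : ∀ i, N i 2 = 0 := by
    intro i
    have := h (Pi.single i 1) (Pi.single 0 1) (Pi.single 0 1)
    rw [left_eq_add] at this
    simpa [mulOf_cM08, formOf, Fin.sum_univ_four, Pi.single_apply] using this
  have h3 : ∀ i, N i 3 = 0 := by
    intro i
    have := h (Pi.single i 1) (Pi.single 1 1) (Pi.single 1 1)
    rw [left_eq_add] at this
    simpa [mulOf_cM08, formOf, Fin.sum_univ_four, Pi.single_apply] using this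
  have h4 := h (Pi.single 0 1) (Pi.single 0 1) (Pi.single 1 1)
  have h5 := h (Pi.single 1 1) (Pi.single 0 1) (Pi.single 1 1)
  simp [mulOf_cM08, formOf, Fin.sum_univ_four, Pi.single_apply, h2, h3] at h4 h5
  exact ⟨h2, h3, h4, h5⟩

theorem formOf_four (M : Matrix (Fin 4) (Fin 4) ℂ) (x y : Fin 4 → ℂ) :
    formOf M x y = (x 0 * M 0 0 * y 0 + x 0 * M 0 1 * y 1 + x 0 * M 0 2 * y 2 + x 0 * M 0 3 * y 3)
      + (x 1 * M 1 0 * y 0 + x 1 * M 1 1 * y 1 + x 1 * M 1 2 * y 2 + x 1 * M 1 3 * y 3)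
      + (x 2 * M 2 0 * y 0 + x 2 * M 2 1 * y 1 + x 2 * M 2 2 * y 2 + x 2 * M 2 3 * y 3)
      + (x 3 * M 3 0 * y 0 + x 3 * M 3 1 * y 1 + x 3 * M 3 2 * y 2 + x 3 * M 3 3 * y 3) := by
  simp only [formOf, Fin.sum_univ_four]

theorem cobound (α : ℂ) (x y g : Fin 4 → ℂ) :
    ∑ l, mulOf (cM08 α) x y l * g l =
      (x 0 * y 0 - α * (x 1 * y 0)) * g 2 + (x 0 * y 1 - x 1 * y 1) * g 3 := by
  rw [mulOf_cM08, Fin.sum_univ_four]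
  simp

theorem comb_four (a : Fin 4 → ℂ) (x y : Fin 4 → ℂ) :
    ∑ i, a i * formOf ((![Δ 1 0, Δ 1 1, Δ 2 0, Δ 3 1] :
        Fin 4 → Matrix (Fin 4) (Fin 4) ℂ) i) x y =
      a 0 * (x 1 * y 0) + a 1 * (x 1 * y 1) + a 2 * (x 2 * y 0) + a 3 * (x 3 * y 1) := by
  rw [Fin.sum_univ_four, ← formOf_Δ, ← formOf_Δ, ← formOf_Δ, ← formOf_Δ]
  rfl

theorem comb_five (a : Fin 5 → ℂ) (x y : Fin 4 → ℂ) :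
    ∑ i, a i * formOf ((![Δ 1 0, Δ 1 1, Δ 2 0, Δ 3 1, Δ 2 1 + Δ 3 0] :
        Fin 5 → Matrix (Fin 4) (Fin 4) ℂ) i) x y =
      a 0 * (x 1 * y 0) + a 1 * (x 1 * y 1) + a 2 * (x 2 * y 0) + a 3 * (x 3 * y 1)
        + a 4 * (x 2 * y 1 + x 3 * y 0) := by
  rw [Fin.sum_univ_five, ← formOf_Δ, ← formOf_Δ, ← formOf_Δ, ← formOf_Δ, ← formOf_Δ,
    ← formOf_Δ, ← formOf_add]
  rfl

theorem coc10 (α : ℂ) : IsCocycle (cM08 α) (Δ 1 0) := by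
  intro x y z
  simp only [mulOf_cM08, formOf_Δ]
  simp

theorem coc11 (α : ℂ) : IsCocycle (cM08 α) (Δ 1 1) := by
  intro x y z
  simp only [mulOf_cM08, formOf_Δ]
  simp

theorem coc20 (α : ℂ) : IsCocycle (cM08 α) (Δ 2 0) := by
  intro x y z
  simp only [mulOf_cM08, formOf_Δ]
  simp
  ring

theorem coc31 (α : ℂ) : IsCocycle (cM08 α) (Δ 3 1) := by
  intro x y z
  simp only [mulOf_cM08, formOf_Δ]
  simp
  ring

theorem coc_extra : IsCocycle (cM08 1) (Δ 2 1 + Δ 3 0) := by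
  intro x y z
  simp only [mulOf_cM08, formOf_Δ, formOf_add]
  simp
  ring

/-- If `α ≠ 1` then `H²(𝔑₀₈^α,ℂ)` has dimension 4 with basis `[Δ₂₁], [Δ₂₂], [Δ₃₁], [Δ₄₂]`;
if `α = 1` it has dimension 5 with basis `[Δ₂₁], [Δ₂₂], [Δ₃₁], [Δ₄₂], [Δ₃₂+Δ₄₁]`. -/
theorem statement11 (α : ℂ) :
    (α ≠ 1 → HBasis (cM08 α) ![Δ 1 0, Δ 1 1, Δ 2 0, Δ 3 1]) ∧
    (α = 1 → HBasis (cM08 1) ![Δ 1 0, Δ 1 1, Δ 2 0, Δ 3 1, Δ 2 1 + Δ 3 0]) := by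
  constructor
  · intro hα
    refine ⟨?_, ?_⟩
    · intro i
      fin_cases i
      exacts [coc10 α, coc11 α, coc20 α, coc31 α]
    · intro N hN
      obtain ⟨h2, h3, h4, h5⟩ := cocycle_entries α N hN
      have h6 : N 2 1 = 0 := by
        have : (α - 1) * N 2 1 = 0 := by linear_combination h5 - h4
        exact (mul_eq_zero.mp this).resolve_left (sub_ne_zero.mpr hα)
      have h7 : N 3 0 = 0 := by rw [← h4, h6]
      refine ⟨![N 1 0 + α * N 0 0, N 1 1 + N 0 1, N 2 0, N 3 1],
        ⟨![0, 0, N 0 0, N 0 1], ?_⟩, ?_⟩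
      · intro x y
        rw [comb_four, cobound, formOf_four]
        simp [h2, h3, h6, h7]
        ring
      · rintro a ⟨g, hg⟩
        have e := fun i j => (hg (Pi.single i 1) (Pi.single j 1)).trans
          (congrArg₂ (· + ·) (comb_four a _ _) (cobound _ _ _ g))
        simp only [formOf_single] at e
        have e00 := e 0 0
        have e01 := e 0 1
        have e10 := e 1 0
        have e11 := e 1 1
        have e20 := e 2 0
        have e31 := e 3 1
        simp [Pi.single_apply] at e00 e01 e10 e11 e20 e31
        have f0 : a 0 = N 1 0 + α * N 0 0 := by linear_combination -e10 - α * e00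
        have f1 : a 1 = N 1 1 + N 0 1 := by linear_combination -e11 - e01
        funext i
        fin_cases i
        exacts [f0, f1, e20.symm, e31.symm]
  · intro _
    refine ⟨?_, ?_⟩
    · intro i
      fin_cases i
      exacts [coc10 1, coc11 1, coc20 1, coc31 1, coc_extra]
    · intro N hN
      obtain ⟨h2, h3, h4, -⟩ := cocycle_entries 1 N hN
      refine ⟨![N 1 0 + N 0 0, N 1 1 + N 0 1, N 2 0, N 3 1, N 2 1],
        ⟨![0, 0, N 0 0, N 0 1], ?_⟩, ?_⟩
      · intro x y
        rw [comb_five, cobound, formOf_four]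
        simp [h2, h3, ← h4]
        ring
      · rintro a ⟨g, hg⟩
        have e := fun i j => (hg (Pi.single i 1) (Pi.single j 1)).trans
          (congrArg₂ (· + ·) (comb_five a _ _) (cobound _ _ _ g))
        simp only [formOf_single] at e
        have e00 := e 0 0
        have e01 := e 0 1
        have e10 := e 1 0
        have e11 := e 1 1
        have e20 := e 2 0
        have e31 := e 3 1
        have e21 := e 2 1
        simp [Pi.single_apply] at e00 e01 e10 e11 e20 e31 e21
        have f0 : a 0 = N 1 0 + N 0 0 := by linear_combination -e10 - e00
        have f1 : a 1 = N 1 1 + N 0 1 := by linear_combination -e11 - e01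
        funext i
        fin_cases i
        exacts [f0, f1, e20.symm, e31.symm, e21.symm]
end
end

section
/- For α ∈ ℂ, let 𝔑₁₄^α be the 4-dimensional complex Leibniz algebra with basis e₁,e₂,e₃,e₄ and nonzero products of basis vectors e₁e₂ = e₄, e₂e₁ = αe₄, e₂e₂ = e₃. If α ≠ −1, then H²(𝔑₁₄^α,ℂ) has dimension 4 with basis the classes [Δ₁₁], [Δ₂₁], [Δ₃₂], [αΔ₃₁+Δ₄₂]; if α = −1, then H²(𝔑₁₄^{−1},ℂ) has dimension 6 with basis the classes [Δ₁₁], [Δ₂₁], [Δ₃₂], [−Δ₃₁+Δ₄₂], [Δ₁₄−Δ₄₁], [Δ₂₄−Δ₄₂]. -/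
noncomputable section

/-- The 4-dimensional Leibniz algebra `𝔑₁₄^α`: `e₁e₂ = e₄`, `e₂e₁ = αe₄`, `e₂e₂ = e₃`. -/
def cM14 (α : ℂ) : Fin 4 → Fin 4 → Fin 4 → ℂ := fun i j k =>
  (if i = 0 ∧ j = 1 ∧ k = 3 then 1 else 0) +
  (if i = 1 ∧ j = 0 ∧ k = 3 then α else 0) +
  (if i = 1 ∧ j = 1 ∧ k = 2 then 1 else 0)

theorem mul_cM14 (α : ℂ) (x y : Fin 4 → ℂ) :
    mulOf (cM14 α) x y = ![0, 0, x 1 * y 1, x 0 * y 1 + α * (x 1 * y 0)] := by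
  funext k
  fin_cases k <;> simp [mulOf, cM14, Fin.sum_univ_four]
  ring

theorem form_four (N : Matrix (Fin 4) (Fin 4) ℂ) (x y : Fin 4 → ℂ) :
    formOf N x y =
      (x 0 * N 0 0 * y 0 + x 0 * N 0 1 * y 1 + x 0 * N 0 2 * y 2 + x 0 * N 0 3 * y 3) +
      (x 1 * N 1 0 * y 0 + x 1 * N 1 1 * y 1 + x 1 * N 1 2 * y 2 + x 1 * N 1 3 * y 3) +
      (x 2 * N 2 0 * y 0 + x 2 * N 2 1 * y 1 + x 2 * N 2 2 * y 2 + x 2 * N 2 3 * y 3) +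
      (x 3 * N 3 0 * y 0 + x 3 * N 3 1 * y 1 + x 3 * N 3 2 * y 2 + x 3 * N 3 3 * y 3) := by
  simp [formOf, Fin.sum_univ_four]

theorem form_delta (i j : Fin 4) (x y : Fin 4 → ℂ) : formOf (Δ i j) x y = x i * y j := by
  unfold formOf Δ
  rw [Finset.sum_eq_single i, Finset.sum_eq_single j]
  · simp
  · intro b _ hb
    simp [hb]
  · simp
  · intro b _ hb
    simp [hb]
  · simp

theorem form_add (M N : Matrix (Fin 4) (Fin 4) ℂ) (x y : Fin 4 → ℂ) :
    formOf (M + N) x y = formOf M x y + formOf N x y := by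
  simp only [form_four, Matrix.add_apply]
  ring

theorem form_sub (M N : Matrix (Fin 4) (Fin 4) ℂ) (x y : Fin 4 → ℂ) :
    formOf (M - N) x y = formOf M x y - formOf N x y := by
  simp only [form_four, Matrix.sub_apply]
  ring

theorem form_neg (M : Matrix (Fin 4) (Fin 4) ℂ) (x y : Fin 4 → ℂ) :
    formOf (-M) x y = -formOf M x y := by
  simp only [form_four, Matrix.neg_apply]
  ring

theorem form_smul (a : ℂ) (M : Matrix (Fin 4) (Fin 4) ℂ) (x y : Fin 4 → ℂ) :
    formOf (a • M) x y = a * formOf M x y := by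
  simp only [form_four, Matrix.smul_apply, smul_eq_mul]
  ring

/-- The right-hand side of the basis condition, first family. -/
theorem rhs_four (α : ℂ) (a g x y : Fin 4 → ℂ) :
    (∑ i, a i * formOf ((![Δ 0 0, Δ 1 0, Δ 2 1, α • Δ 2 0 + Δ 3 1] :
      Fin 4 → Matrix (Fin 4) (Fin 4) ℂ) i) x y) + ∑ l, mulOf (cM14 α) x y l * g l =
    a 0 * (x 0 * y 0) + a 1 * (x 1 * y 0) + a 2 * (x 2 * y 1) +
      a 3 * (α * (x 2 * y 0) + x 3 * y 1) +
      (x 1 * y 1 * g 2 + (x 0 * y 1 + α * (x 1 * y 0)) * g 3) := by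
  rw [Fin.sum_univ_four, Fin.sum_univ_four, mul_cM14]
  change a 0 * formOf (Δ 0 0) x y + a 1 * formOf (Δ 1 0) x y + a 2 * formOf (Δ 2 1) x y +
    a 3 * formOf (α • Δ 2 0 + Δ 3 1) x y + (0 * g 0 + 0 * g 1 + x 1 * y 1 * g 2 +
    (x 0 * y 1 + α * (x 1 * y 0)) * g 3) = _
  simp only [form_add, form_smul, form_delta]
  ring

/-- The right-hand side of the basis condition, second family. -/
theorem rhs_six (a : Fin 6 → ℂ) (g x y : Fin 4 → ℂ) :
    (∑ i, a i * formOf ((![Δ 0 0, Δ 1 0, Δ 2 1, -Δ 2 0 + Δ 3 1, Δ 0 3 - Δ 3 0, Δ 1 3 - Δ 3 1] :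
      Fin 6 → Matrix (Fin 4) (Fin 4) ℂ) i) x y) + ∑ l, mulOf (cM14 (-1)) x y l * g l =
    a 0 * (x 0 * y 0) + a 1 * (x 1 * y 0) + a 2 * (x 2 * y 1) +
      a 3 * (-(x 2 * y 0) + x 3 * y 1) + a 4 * (x 0 * y 3 - x 3 * y 0) +
      a 5 * (x 1 * y 3 - x 3 * y 1) +
      (x 1 * y 1 * g 2 + (x 0 * y 1 + (-1) * (x 1 * y 0)) * g 3) := by
  rw [Fin.sum_univ_six, Fin.sum_univ_four, mul_cM14]
  change a 0 * formOf (Δ 0 0) x y + a 1 * formOf (Δ 1 0) x y + a 2 * formOf (Δ 2 1) x y +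
    a 3 * formOf (-Δ 2 0 + Δ 3 1) x y + a 4 * formOf (Δ 0 3 - Δ 3 0) x y +
    a 5 * formOf (Δ 1 3 - Δ 3 1) x y + (0 * g 0 + 0 * g 1 + x 1 * y 1 * g 2 +
    (x 0 * y 1 + (-1) * (x 1 * y 0)) * g 3) = _
  simp only [form_add, form_sub, form_neg, form_delta]
  ring

/-- Values of a cocycle on the basis. -/
theorem cocycle_values (α : ℂ) (N : Matrix (Fin 4) (Fin 4) ℂ) (h : IsCocycle (cM14 α) N) :
    (∀ i, N i 2 = 0) ∧ (∀ i, (1 + α) * N i 3 = 0) ∧ N 2 3 = 0 ∧ N 3 3 = 0 ∧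
    N 3 0 = α * N 0 3 ∧ N 2 0 = α * N 3 1 + α * N 1 3 := by
  have key : ∀ i : Fin 4, N i 2 = 0 ∧ (1 + α) * N i 3 = 0 := by
    intro i
    have h1 := h (Pi.single i 1) (Pi.single 1 1) (Pi.single 1 1)
    have h2 := h (Pi.single i 1) (Pi.single 0 1) (Pi.single 1 1)
    have h3 := h (Pi.single i 1) (Pi.single 1 1) (Pi.single 0 1)
    simp only [mul_cM14, form_four] at h1 h2 h3
    fin_cases i <;> simp at h1 h2 h3 ⊢ <;> refine ⟨by grind, ?_⟩ <;>
      grind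
  have h1 := h (Pi.single 1 1) (Pi.single 1 1) (Pi.single 3 1)
  have h2 := h (Pi.single 0 1) (Pi.single 1 1) (Pi.single 3 1)
  have h3 := h (Pi.single 0 1) (Pi.single 1 1) (Pi.single 0 1)
  have h4 := h (Pi.single 1 1) (Pi.single 1 1) (Pi.single 0 1)
  simp only [mul_cM14, form_four] at h1 h2 h3 h4
  simp at h1 h2 h3 h4
  refine ⟨fun i => (key i).1, fun i => (key i).2, h1, h2, ?_, ?_⟩ <;> grind

/-- If `α ≠ -1` then `H²(𝔑₁₄^α,ℂ)` has dimension 4 with basis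
`[Δ₁₁], [Δ₂₁], [Δ₃₂], [αΔ₃₁+Δ₄₂]`; if `α = -1` it has dimension 6 with basis
`[Δ₁₁], [Δ₂₁], [Δ₃₂], [-Δ₃₁+Δ₄₂], [Δ₁₄-Δ₄₁], [Δ₂₄-Δ₄₂]`. -/
theorem statement13 (α : ℂ) :
    (α ≠ -1 → HBasis (cM14 α) ![Δ 0 0, Δ 1 0, Δ 2 1, α • Δ 2 0 + Δ 3 1]) ∧
    (α = -1 → HBasis (cM14 (-1))
      ![Δ 0 0, Δ 1 0, Δ 2 1, -Δ 2 0 + Δ 3 1, Δ 0 3 - Δ 3 0, Δ 1 3 - Δ 3 1]) := by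
  constructor
  · intro hα
    have hα' : 1 + α ≠ 0 := fun h => hα (by linear_combination h)
    refine ⟨?_, ?_⟩
    · intro i x y z
      rw [mul_cM14, mul_cM14, mul_cM14]
      fin_cases i
      · change formOf (Δ 0 0) _ _ = formOf (Δ 0 0) _ _ + formOf (Δ 0 0) _ _
        simp [form_add, form_sub, form_neg, form_smul, form_delta]
        try ring
      · change formOf (Δ 1 0) _ _ = formOf (Δ 1 0) _ _ + formOf (Δ 1 0) _ _
        simp [form_add, form_sub, form_neg, form_smul, form_delta]
        try ring
      · change formOf (Δ 2 1) _ _ = formOf (Δ 2 1) _ _ + formOf (Δ 2 1) _ _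
        simp [form_add, form_sub, form_neg, form_smul, form_delta]
        try ring
      · change formOf (α • Δ 2 0 + Δ 3 1) _ _ = formOf (α • Δ 2 0 + Δ 3 1) _ _ + formOf (α • Δ 2 0 + Δ 3 1) _ _
        simp [form_add, form_sub, form_neg, form_smul, form_delta]
        try ring
    · intro N hN
      obtain ⟨k2, k3, -, -, h30, h20⟩ := cocycle_values α N hN
      have k3' : ∀ i, N i 3 = 0 := fun i => (mul_eq_zero.mp (k3 i)).resolve_left hα'
      refine ⟨![N 0 0, N 1 0 - α * N 0 1, N 2 1, N 3 1], ⟨![0, 0, N 1 1, N 0 1], ?_⟩, ?_⟩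
      · intro x y
        rw [rhs_four, form_four]
        simp [k2, k3', h30, h20]
        ring
      · rintro a ⟨g, hg⟩
        replace hg := fun x y => (hg x y).trans (rhs_four α a g x y)
        simp only [form_four] at hg
        have e00 := hg (Pi.single 0 1) (Pi.single 0 1)
        have e01 := hg (Pi.single 0 1) (Pi.single 1 1)
        have e10 := hg (Pi.single 1 1) (Pi.single 0 1)
        have e21 := hg (Pi.single 2 1) (Pi.single 1 1)
        have e31 := hg (Pi.single 3 1) (Pi.single 1 1)
        simp at e00 e01 e10 e21 e31
        funext i
        fin_cases i <;> simp <;> grind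
  · rintro rfl
    refine ⟨?_, ?_⟩
    · intro i x y z
      rw [mul_cM14, mul_cM14, mul_cM14]
      fin_cases i
      · change formOf (Δ 0 0) _ _ = formOf (Δ 0 0) _ _ + formOf (Δ 0 0) _ _
        simp [form_add, form_sub, form_neg, form_smul, form_delta]
        try ring
      · change formOf (Δ 1 0) _ _ = formOf (Δ 1 0) _ _ + formOf (Δ 1 0) _ _
        simp [form_add, form_sub, form_neg, form_smul, form_delta]
        try ring
      · change formOf (Δ 2 1) _ _ = formOf (Δ 2 1) _ _ + formOf (Δ 2 1) _ _
        simp [form_add, form_sub, form_neg, form_smul, form_delta]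
        try ring
      · change formOf (-Δ 2 0 + Δ 3 1) _ _ = formOf (-Δ 2 0 + Δ 3 1) _ _ + formOf (-Δ 2 0 + Δ 3 1) _ _
        simp [form_add, form_sub, form_neg, form_smul, form_delta]
        try ring
      · change formOf (Δ 0 3 - Δ 3 0) _ _ = formOf (Δ 0 3 - Δ 3 0) _ _ + formOf (Δ 0 3 - Δ 3 0) _ _
        simp [form_add, form_sub, form_neg, form_smul, form_delta]
        try ring
      · change formOf (Δ 1 3 - Δ 3 1) _ _ = formOf (Δ 1 3 - Δ 3 1) _ _ + formOf (Δ 1 3 - Δ 3 1) _ _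
        simp [form_add, form_sub, form_neg, form_smul, form_delta]
        try ring
    · intro N hN
      obtain ⟨k2, -, h23, h33, h30, h20⟩ := cocycle_values (-1) N hN
      refine ⟨![N 0 0, N 1 0 + N 0 1, N 2 1, N 3 1 + N 1 3, N 0 3, N 1 3],
        ⟨![0, 0, N 1 1, N 0 1], ?_⟩, ?_⟩
      · intro x y
        rw [rhs_six, form_four]
        simp [k2, h23, h33, h30, h20]
        ring
      · rintro a ⟨g, hg⟩
        replace hg := fun x y => (hg x y).trans (rhs_six a g x y)
        simp only [form_four] at hg
        have e00 := hg (Pi.single 0 1) (Pi.single 0 1)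
        have e01 := hg (Pi.single 0 1) (Pi.single 1 1)
        have e10 := hg (Pi.single 1 1) (Pi.single 0 1)
        have e21 := hg (Pi.single 2 1) (Pi.single 1 1)
        have e31 := hg (Pi.single 3 1) (Pi.single 1 1)
        have e03 := hg (Pi.single 0 1) (Pi.single 3 1)
        have e13 := hg (Pi.single 1 1) (Pi.single 3 1)
        simp at e00 e01 e10 e21 e31 e03 e13
        funext i
        fin_cases i <;> simp <;> grind
end
end
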